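/- Let q be a complex number with 0 < |q| < 1, and let a, ρ₁, ρ₂ be nonzero complex numbers such that (aq;q)_m ≠ 0, (aq/ρ₁;q)_m ≠ 0, and (aq/ρ₂;q)_m ≠ 0 for all m ≥ 0. Suppose (α_n, β_n)_{n ≥ 0} is a Bailey pair with parameters (a, q). Define α'_n = ((ρ₁;q)_n (ρ₂;q)_n / ((aq/ρ₁;q)_n (aq/ρ₂;q)_n)) (aq/(ρ₁ρ₂))^n α_n and β'_n = ∑_{r=0}^{n} (ρ₁;q)_r (ρ₂;q)_r (aq/(ρ₁ρ₂);q)_{n−r} (aq/(ρ₁ρ₂))^r β_r / ((aq/ρ₁;q)_n (aq/ρ₂;q)_n (q;q)_{n−r}). Then (α'_n, β'_n)_{n ≥ 0} is a Bailey pair with parameters (a, q). -/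

import Mathlib

open Finset

/-- Finite q-Pochhammer symbol `(x;q)_n`. -/
noncomputable def qPoch (q x : ℂ) (n : ℕ) : ℂ :=
  ∏ j ∈ Finset.range n, (1 - x * q ^ j)

/-- `(α, β)` is a Bailey pair with parameters `(a, q)` if
`β_n = ∑_{r=0}^n α_r / ((q;q)_{n-r} (aq;q)_{n+r})` for all `n ≥ 0`. -/
def IsBaileyPair (q a : ℂ) (α β : ℕ → ℂ) : Prop :=
  ∀ n : ℕ, β n = ∑ r ∈ Finset.range (n + 1),
    α r / (qPoch q q (n - r) * qPoch q (a * q) (n + r))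

lemma qPoch_zero (q x : ℂ) : qPoch q x 0 = 1 := by
  simp [qPoch]

lemma qPoch_succ (q x : ℂ) (n : ℕ) :
    qPoch q x (n + 1) = qPoch q x n * (1 - x * q ^ n) :=
  Finset.prod_range_succ _ n

lemma qPoch_add (q x : ℂ) (m n : ℕ) :
    qPoch q x (m + n) = qPoch q x m * qPoch q (x * q ^ m) n := by
  simp only [qPoch, Finset.prod_range_add, pow_add, mul_assoc]

lemma one_sub_mul_pow_ne_zero {q x : ℂ} (h : ∀ m, qPoch q x m ≠ 0) (n : ℕ) :
    1 - x * q ^ n ≠ 0 := by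
  have := h (n + 1)
  rw [qPoch_succ] at this
  exact right_ne_zero_of_mul this

lemma qPoch_self_ne_zero {q : ℂ} (hq : ‖q‖ < 1) (n : ℕ) : qPoch q q n ≠ 0 := by
  refine Finset.prod_ne_zero_iff.2 fun j _ h => ?_
  have h1 : ‖q ^ (j + 1)‖ < 1 := by
    rw [norm_pow]
    exact pow_lt_one₀ (norm_nonneg q) hq j.succ_ne_zero
  rw [← pow_succ', sub_eq_zero] at h
  simp [← h] at h1

/-- The summand of the q-Pfaff–Saalschütz sum. -/
noncomputable def saalschutzTerm (q b c d e : ℂ) (n j : ℕ) : ℂ :=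
  qPoch q b j * qPoch q c j * qPoch q d (n - j) * d ^ j /
    (qPoch q q j * qPoch q q (n - j) * qPoch q e j)

/-- The telescoping certificate for the recurrence in `n` of the q-Pfaff–Saalschütz sum. -/
noncomputable def saalschutzCert (q b c d e : ℂ) (n : ℕ) : ℕ → ℂ
  | 0 => 0
  | j + 1 => -(q ^ (n - j) * qPoch q b (j + 1) * qPoch q c (j + 1) * qPoch q d (n - j) *
      d ^ (j + 1) / (qPoch q q j * qPoch q q (n - j) * qPoch q e j))

lemma saalschutzTerm_recurrence {q b c d e : ℂ} (hbcd : b * c * d = e) (hq : ∀ m, qPoch q q m ≠ 0)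
    (he : ∀ m, qPoch q e m ≠ 0) {n j : ℕ} (hj : j ≤ n) :
    (1 - q * q ^ n) * (1 - e * q ^ n) * saalschutzTerm q b c d e (n + 1) j -
        (1 - b * d * q ^ n) * (1 - c * d * q ^ n) * saalschutzTerm q b c d e n j =
      saalschutzCert q b c d e n (j + 1) - saalschutzCert q b c d e n j := by
  obtain ⟨k, rfl⟩ := Nat.exists_eq_add_of_le hj
  have hqk := hq k
  have hk := one_sub_mul_pow_ne_zero hq k
  cases j with
  | zero =>
    simp only [saalschutzTerm, saalschutzCert, zero_add, Nat.sub_zero, qPoch_succ, qPoch_zero]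
    generalize hu : 1 - q * q ^ k = u at *
    field_simp
    subst hu hbcd
    ring
  | succ i =>
    have hqi := hq i
    have hei := he i
    have hi := one_sub_mul_pow_ne_zero hq i
    have hi' := one_sub_mul_pow_ne_zero he i
    have e1 : i + 1 + k + 1 - (i + 1) = k + 1 := by omega
    have e2 : i + 1 + k - (i + 1) = k := by omega
    have e3 : i + 1 + k - i = k + 1 := by omega
    simp only [saalschutzTerm, saalschutzCert, e1, e2, e3, qPoch_succ]
    generalize hu : 1 - q * q ^ k = u at *
    generalize hv : 1 - q * q ^ i = v at *
    generalize hw : 1 - e * q ^ i = w at *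
    field_simp
    subst hu hv hw hbcd
    ring

/-- The q-Pfaff–Saalschütz sum. -/
theorem sum_saalschutzTerm {q b c d e : ℂ} (hbcd : b * c * d = e) (hq : ∀ m, qPoch q q m ≠ 0)
    (he : ∀ m, qPoch q e m ≠ 0) (n : ℕ) :
    ∑ j ∈ Finset.range (n + 1), saalschutzTerm q b c d e n j =
      qPoch q (b * d) n * qPoch q (c * d) n / (qPoch q q n * qPoch q e n) := by
  induction n with
  | zero => simp [saalschutzTerm, qPoch_zero]
  | succ n ih =>
    have hqn := hq n
    have hen := he n
    have hn := one_sub_mul_pow_ne_zero hq n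
    have hn' := one_sub_mul_pow_ne_zero he n
    have tele := Finset.sum_congr rfl fun j (hj : j ∈ Finset.range (n + 1)) =>
      saalschutzTerm_recurrence hbcd hq he
        (Nat.lt_succ_iff.1 (Finset.mem_range.1 hj))
    rw [Finset.sum_range_sub, Finset.sum_sub_distrib, ← Finset.mul_sum, ← Finset.mul_sum,
      ih] at tele
    have last : saalschutzCert q b c d e n (n + 1) - saalschutzCert q b c d e n 0 =
        -((1 - q * q ^ n) * (1 - e * q ^ n) *
          saalschutzTerm q b c d e (n + 1) (n + 1)) := by
      simp only [saalschutzTerm, saalschutzCert, Nat.sub_self, qPoch_succ, qPoch_zero]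
      generalize 1 - q * q ^ n = u at *
      generalize 1 - e * q ^ n = v at *
      field_simp
      ring
    rw [last] at tele
    have key : (1 - q * q ^ n) * (1 - e * q ^ n) *
        ∑ j ∈ Finset.range (n + 1 + 1), saalschutzTerm q b c d e (n + 1) j =
        (1 - b * d * q ^ n) * (1 - c * d * q ^ n) *
          (qPoch q (b * d) n * qPoch q (c * d) n / (qPoch q q n * qPoch q e n)) := by
      rw [Finset.sum_range_succ]
      linear_combination tele
    apply mul_left_cancel₀ (mul_ne_zero hn hn')
    rw [key]
    simp only [qPoch_succ]
    generalize 1 - q * q ^ n = u at *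
    generalize 1 - e * q ^ n = v at *
    field_simp

/-- The inner sum of Bailey's lemma after interchanging the order of summation. -/
lemma bailey_kernel_sum {q a ρ₁ ρ₂ : ℂ} (hq1 : ‖q‖ < 1) (hρ₁ : ρ₁ ≠ 0) (hρ₂ : ρ₂ ≠ 0)
    (haq : ∀ m : ℕ, qPoch q (a * q) m ≠ 0)
    (haq₁ : ∀ m : ℕ, qPoch q (a * q / ρ₁) m ≠ 0)
    (haq₂ : ∀ m : ℕ, qPoch q (a * q / ρ₂) m ≠ 0) (r n : ℕ) :
    ∑ j ∈ Finset.range (n + 1),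
      qPoch q ρ₁ (r + j) * qPoch q ρ₂ (r + j) * qPoch q (a * q / (ρ₁ * ρ₂)) (n - j) *
          (a * q / (ρ₁ * ρ₂)) ^ (r + j) /
        (qPoch q (a * q / ρ₁) (r + n) * qPoch q (a * q / ρ₂) (r + n) * qPoch q q (n - j) *
          (qPoch q q j * qPoch q (a * q) (r + j + r))) =
      qPoch q ρ₁ r * qPoch q ρ₂ r / (qPoch q (a * q / ρ₁) r * qPoch q (a * q / ρ₂) r) *
        (a * q / (ρ₁ * ρ₂)) ^ r / (qPoch q q n * qPoch q (a * q) (r + n + r)) := by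
  set d := a * q / (ρ₁ * ρ₂) with hd
  have hq := qPoch_self_ne_zero hq1
  have hprod : ρ₁ * q ^ r * (ρ₂ * q ^ r) * d = a * q * q ^ (r + r) := by
    rw [hd, pow_add]
    field_simp
  have hb : ρ₁ * q ^ r * d = a * q / ρ₂ * q ^ r := by
    rw [hd]
    field_simp
  have hc : ρ₂ * q ^ r * d = a * q / ρ₁ * q ^ r := by
    rw [hd]
    field_simp
  have he : ∀ m, qPoch q (a * q * q ^ (r + r)) m ≠ 0 := fun m => by
    have := haq (r + r + m)
    rw [qPoch_add] at this
    exact right_ne_zero_of_mul this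
  have saal := sum_saalschutzTerm hprod hq he n
  simp only [saalschutzTerm] at saal
  rw [hb, hc] at saal
  have h₁ := haq₁ (r + n)
  have h₂ := haq₂ (r + n)
  rw [qPoch_add] at h₁ h₂
  have h₁' := right_ne_zero_of_mul h₁
  have h₂' := right_ne_zero_of_mul h₂
  have h₁r := haq₁ r
  have h₂r := haq₂ r
  have h2r := haq (r + r)
  have hqn := hq n
  have hen := he n
  have split : ∀ m, qPoch q (a * q) (r + m + r) =
      qPoch q (a * q) (r + r) * qPoch q (a * q * q ^ (r + r)) m := fun m => by
    rw [← qPoch_add]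
    congr 1
    ring
  simp only [split, qPoch_add q ρ₁ r, qPoch_add q ρ₂ r, qPoch_add q (a * q / ρ₁) r,
    qPoch_add q (a * q / ρ₂) r, pow_add d]
  generalize qPoch q (a * q * q ^ (r + r)) = E at *
  generalize qPoch q (a * q / ρ₁ * q ^ r) = F₁ at *
  generalize qPoch q (a * q / ρ₂ * q ^ r) = F₂ at *
  generalize qPoch q (a * q / ρ₁) = G₁ at *
  generalize qPoch q (a * q / ρ₂) = G₂ at *
  trans qPoch q ρ₁ r * qPoch q ρ₂ r * d ^ r /
    (G₁ r * F₁ n * (G₂ r * F₂ n) * qPoch q (a * q) (r + r)) * (F₂ n * F₁ n / (qPoch q q n * E n))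
  · rw [← saal, Finset.mul_sum]
    refine Finset.sum_congr rfl fun j _ => ?_
    rw [div_mul_div_comm]
    congr 1 <;> ring
  · generalize qPoch q (a * q) (r + r) = A at *
    field_simp

/-- Bailey's lemma. -/
theorem bailey_lemma (q a ρ₁ ρ₂ : ℂ) (hq0 : 0 < ‖q‖) (hq1 : ‖q‖ < 1)
    (ha : a ≠ 0) (hρ₁ : ρ₁ ≠ 0) (hρ₂ : ρ₂ ≠ 0)
    (haq : ∀ m : ℕ, qPoch q (a * q) m ≠ 0)
    (haq₁ : ∀ m : ℕ, qPoch q (a * q / ρ₁) m ≠ 0)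
    (haq₂ : ∀ m : ℕ, qPoch q (a * q / ρ₂) m ≠ 0)
    (α β : ℕ → ℂ) (hpair : IsBaileyPair q a α β) :
    IsBaileyPair q a
      (fun n => qPoch q ρ₁ n * qPoch q ρ₂ n /
          (qPoch q (a * q / ρ₁) n * qPoch q (a * q / ρ₂) n) *
          (a * q / (ρ₁ * ρ₂)) ^ n * α n)
      (fun n => ∑ r ∈ Finset.range (n + 1),
        qPoch q ρ₁ r * qPoch q ρ₂ r * qPoch q (a * q / (ρ₁ * ρ₂)) (n - r) *
            (a * q / (ρ₁ * ρ₂)) ^ r * β r /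
          (qPoch q (a * q / ρ₁) n * qPoch q (a * q / ρ₂) n * qPoch q q (n - r))) := by
  intro n
  simp only [hpair _, Finset.mul_sum, Finset.sum_div]
  rw [Finset.sum_comm' (t' := Finset.range (n + 1)) (s' := fun r => Finset.Ico r (n + 1))
    (by intro k r; simp only [Finset.mem_range, Finset.mem_Ico]; omega)]
  refine Finset.sum_congr rfl fun r hr => ?_
  obtain ⟨m, rfl⟩ := Nat.exists_eq_add_of_le (Nat.lt_succ_iff.1 (Finset.mem_range.1 hr))
  have hm : r + m + 1 - r = m + 1 := by omega
  have hm' : r + m - r = m := by omega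
  rw [Finset.sum_Ico_eq_sum_range, hm, hm', mul_div_right_comm _ (α r),
    ← bailey_kernel_sum hq1 hρ₁ hρ₂ haq haq₁ haq₂ r m, Finset.sum_mul]
  refine Finset.sum_congr rfl fun j _ => ?_
  rw [Nat.add_sub_add_left, Nat.add_sub_cancel_left, ← mul_div_assoc, div_div,
    div_mul_eq_mul_div]
  congr 1
  ring
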